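/- Let n ≥ 8 and let 𝒻 be a family of 3-element subsets of [n] that shatters no 3-element subset, with |𝒻| ≥ C(n−1, 2) + 2. Assume further that for every x ∈ [n], every family of 3-element subsets of [n] \ {x} that shatters no 3-element subset has size at most C(n−2, 2) + 1. Then for every x ∈ [n], |𝒻(x)| ≥ n − 1. -/

import Mathlib

/-- A family `𝒻` shatters a set `S` if every subset of `S` is the trace of some member of `𝒻`. -/
def Shatters (𝒻 : Finset (Finset ℕ)) (S : Finset ℕ) : Prop :=
  ∀ T ⊆ S, ∃ F ∈ 𝒻, F ∩ S = T

/-- Under the inductive hypothesis and the size assumption `|𝒻| ≥ C(n-1,2) + 2`,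
every element `x ∈ [n]` lies in at least `n - 1` members of `𝒻`. -/
theorem stmt_7 (n : ℕ) (hn : 8 ≤ n) (𝒻 : Finset (Finset ℕ))
    (hsub : ∀ F ∈ 𝒻, F ⊆ Finset.Icc 1 n) (hcard : ∀ F ∈ 𝒻, F.card = 3)
    (hVC : ∀ S ⊆ Finset.Icc 1 n, S.card = 3 → ¬ Shatters 𝒻 S)
    (hbig : (n - 1).choose 2 + 2 ≤ 𝒻.card)
    (ih : ∀ x ∈ Finset.Icc 1 n, ∀ 𝒢 : Finset (Finset ℕ),
      (∀ G ∈ 𝒢, G ⊆ Finset.Icc 1 n \ {x}) → (∀ G ∈ 𝒢, G.card = 3) →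
      (∀ S ⊆ Finset.Icc 1 n \ {x}, S.card = 3 → ¬ Shatters 𝒢 S) →
      𝒢.card ≤ (n - 2).choose 2 + 1) :
    ∀ x ∈ Finset.Icc 1 n, n - 1 ≤ (𝒻.filter (fun F => x ∈ F)).card := by
  intro x hx
  have hdel := ih x hx (𝒻.filter (fun F => x ∉ F))
    (fun G hG => by
      rw [Finset.mem_filter] at hG
      exact Finset.subset_sdiff.2 ⟨hsub G hG.1, Finset.disjoint_singleton_right.2 hG.2⟩)
    (fun G hG => hcard G (Finset.mem_filter.1 hG).1)
    (fun S hS hS3 hsh => hVC S (hS.trans Finset.sdiff_subset) hS3 fun T hT => by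
      obtain ⟨F, hF, hFT⟩ := hsh T hT
      exact ⟨F, (Finset.mem_filter.1 hF).1, hFT⟩)
  have hsplit := Finset.card_filter_add_card_filter_not (s := 𝒻) (fun F => x ∈ F)
  have hpascal : (n - 1).choose 2 = (n - 2) + (n - 2).choose 2 := by
    obtain ⟨m, rfl⟩ := Nat.exists_eq_add_of_le' hn
    simpa using Nat.choose_succ_succ (m + 6) 1
  omega
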